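/- Let p be a prime and let K be an algebraic closure of ℚ_p with its unique absolute value |·| extending the p-adic one. For every ε > 0 and every δ with 0 < δ < 1, there exists r₀ such that for all r ≥ r₀ the following holds: for d = p^{2r}, ζ ∈ K a primitive d-th root of unity, and every integer n with 0 ≤ n ≤ d−1 and n ∉ [((1−δ)/2)(d−1), ((1+δ)/2)(d−1)], one has |Ω_{r,n}(ζ)| ≤ max{1, p^r |(ζ;ζ)_n|} · ε, where (ζ;ζ)_n = ∏_{k=1}^{n}(1 − ζ^k). -/

import Mathlib

/-- The `q`-Pochhammer symbol `(q;q)_n = ∏_{k=1}^n (1 - q^k)` in `ℤ[q]`. -/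
noncomputable def qPoch (n : ℕ) : Polynomial ℤ :=
  ∏ i ∈ Finset.range n, (1 - Polynomial.X ^ (i + 1))

open Polynomial in
lemma qPoch_succ (n : ℕ) : qPoch (n + 1) = qPoch n * (1 - X ^ (n + 1)) :=
  Finset.prod_range_succ _ _

open Polynomial in
lemma qPoch_ne_zero (n : ℕ) : qPoch n ≠ 0 := by
  refine Finset.prod_ne_zero_iff.2 fun i _ h => ?_
  have := congrArg (Polynomial.eval 0) h
  simp at this

lemma aeval_qPoch {K : Type*} [Field K] (ζ : K) (n : ℕ) :
    Polynomial.aeval ζ (qPoch n) = ∏ k ∈ Finset.range n, (1 - ζ ^ (k + 1)) := by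
  simp [qPoch, map_prod]

section QBinomial

variable {B : ℕ → ℕ → Polynomial ℤ}

lemma qBinom_zero_right
    (hB1 : ∀ n k : ℕ, k ≤ n → B n k * (qPoch k * qPoch (n - k)) = qPoch n) (n : ℕ) :
    B n 0 = 1 := by
  have h := hB1 n 0 (Nat.zero_le n)
  refine mul_right_cancel₀ (qPoch_ne_zero n) ?_
  simpa [qPoch] using h

lemma qBinom_self
    (hB1 : ∀ n k : ℕ, k ≤ n → B n k * (qPoch k * qPoch (n - k)) = qPoch n) (n : ℕ) :
    B n n = 1 := by
  have h := hB1 n n le_rfl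
  refine mul_right_cancel₀ (qPoch_ne_zero n) ?_
  simpa [qPoch] using h

open Polynomial in
/-- The `q`-Pascal identity. -/
lemma qBinom_succ_succ (hB0 : ∀ n k : ℕ, n < k → B n k = 0)
    (hB1 : ∀ n k : ℕ, k ≤ n → B n k * (qPoch k * qPoch (n - k)) = qPoch n) {n k : ℕ}
    (hk : k ≤ n) :
    B (n + 1) (k + 1) = B n (k + 1) + X ^ (n - k) * B n k := by
  obtain rfl | hlt := hk.eq_or_lt
  · simp [qBinom_self hB1, hB0]
  obtain ⟨m, rfl⟩ := Nat.exists_eq_add_of_lt hlt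
  have h1 := hB1 (k + m + 1 + 1) (k + 1) (by omega)
  have h2 := hB1 (k + m + 1) (k + 1) (by omega)
  have h3 := hB1 (k + m + 1) k (by omega)
  rw [show k + m + 1 + 1 - (k + 1) = m + 1 by omega] at h1
  rw [show k + m + 1 - (k + 1) = m by omega] at h2
  rw [show k + m + 1 - k = m + 1 by omega] at h3 ⊢
  refine mul_right_cancel₀ (mul_ne_zero (qPoch_ne_zero (k + 1)) (qPoch_ne_zero (m + 1))) ?_
  rw [h1, qPoch_succ (k + m + 1), add_mul]
  rw [show B (k + m + 1) (k + 1) * (qPoch (k + 1) * qPoch (m + 1))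
      = (B (k + m + 1) (k + 1) * (qPoch (k + 1) * qPoch m)) * (1 - X ^ (m + 1)) by
    rw [qPoch_succ m]; ring, h2]
  rw [show X ^ (m + 1) * B (k + m + 1) k * (qPoch (k + 1) * qPoch (m + 1))
      = X ^ (m + 1) * (1 - X ^ (k + 1)) * (B (k + m + 1) k * (qPoch k * qPoch (m + 1))) by
    rw [qPoch_succ k]; ring, h3]
  ring

/-- The `q`-binomial theorem. -/
lemma prod_one_sub_mul_pow_eq_sum (hB0 : ∀ n k : ℕ, n < k → B n k = 0)
    (hB1 : ∀ n k : ℕ, k ≤ n → B n k * (qPoch k * qPoch (n - k)) = qPoch n)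
    {K : Type*} [Field K] (q x : K) (n : ℕ) :
    ∏ j ∈ Finset.range n, (1 - x * q ^ j) =
      ∑ k ∈ Finset.range (n + 1),
        (-1) ^ k * q ^ (k.choose 2) * Polynomial.aeval q (B n k) * x ^ k := by
  induction n with
  | zero => simp [qBinom_zero_right hB1]
  | succ n ih =>
    have hlast : Polynomial.aeval q (B n (n + 1)) = 0 := by simp [hB0]
    have hsplit : ∑ k ∈ Finset.range (n + 1),
        (-1) ^ k * q ^ (k.choose 2) * Polynomial.aeval q (B n k) * x ^ k =
        ∑ k ∈ Finset.range (n + 1), (-1) ^ (k + 1) * q ^ ((k + 1).choose 2) *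
          Polynomial.aeval q (B n (k + 1)) * x ^ (k + 1) + 1 := by
      have h := Finset.sum_range_succ' (fun k =>
        (-1) ^ k * q ^ (k.choose 2) * Polynomial.aeval q (B n k) * x ^ k) (n + 1)
      rw [Finset.sum_range_succ, hlast] at h
      simpa [qBinom_zero_right hB1] using h
    rw [Finset.prod_range_succ, ih, mul_sub, mul_one, Finset.sum_range_succ' _ (n + 1)]
    nth_rewrite 1 [hsplit]
    rw [Finset.sum_mul, add_sub_right_comm, ← Finset.sum_sub_distrib]
    congr 1
    · refine Finset.sum_congr rfl fun k hk => ?_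
      have hkn : k ≤ n := by simpa [Nat.lt_succ_iff] using hk
      have hq : q ^ n = q ^ (n - k) * q ^ k := by rw [← pow_add, Nat.sub_add_cancel hkn]
      rw [qBinom_succ_succ hB0 hB1 hkn, show (k + 1).choose 2 = k + k.choose 2 by
        rw [Nat.choose_succ_succ' k 1, Nat.choose_one_right]]
      simp only [map_add, map_mul, map_pow, Polynomial.aeval_X]
      rw [hq]
      ring
    · simp [qBinom_zero_right hB1]

end QBinomial

section AbsoluteValue

variable {K : Type*} [Field K] {v : AbsoluteValue K ℝ}

lemma AbsoluteValue.isNonarchimedean_of_natCast_le_one (h : ∀ n : ℕ, v n ≤ 1) :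
    IsNonarchimedean v := by
  let := v.toNormedField
  have := IsUltrametricDist.isUltrametricDist_of_forall_norm_natCast_le_one (R := K) h
  exact fun x y => IsUltrametricDist.norm_add_le_max x y

lemma IsNonarchimedean.sum_le_of_forall_le (hna : IsNonarchimedean v) {ι : Type*}
    {s : Finset ι} {f : ι → K} {c : ℝ} (hc : 0 ≤ c) (h : ∀ i ∈ s, v (f i) ≤ c) :
    v (∑ i ∈ s, f i) ≤ c := by
  obtain rfl | hs := s.eq_empty_or_nonempty
  · simpa
  · exact (hna.apply_sum_le_sup hs).trans (Finset.sup'_le _ _ h)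

lemma IsNonarchimedean.aeval_int_le_one (hna : IsNonarchimedean v) {x : K} (hx : v x ≤ 1)
    (P : Polynomial ℤ) : v (Polynomial.aeval x P) ≤ 1 := by
  rw [Polynomial.aeval_eq_sum_range]
  refine hna.sum_le_of_forall_le zero_le_one fun i _ => ?_
  rw [zsmul_eq_mul, map_mul, map_pow]
  exact mul_le_one₀ hna.apply_intCast_le_one (by positivity)
    (pow_le_one₀ (by positivity) hx)

lemma AbsoluteValue.eq_one_of_pow_eq_one {x : K} {d : ℕ} (hd : d ≠ 0) (h : x ^ d = 1) :
    v x = 1 := by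
  rw [← pow_eq_one_iff_of_nonneg (v.nonneg x) hd, ← map_pow, h, map_one]

/-- Reflection: `|(ζ;ζ)_n| |(ζ;ζ)_{d-1-n}| = |d|`. -/
lemma IsPrimitiveRoot.abv_prod_mul_abv_prod {n m : ℕ} {ζ : K}
    (hζ : IsPrimitiveRoot ζ (n + m + 1)) :
    v (∏ k ∈ Finset.range n, (1 - ζ ^ (k + 1))) * v (∏ k ∈ Finset.range m, (1 - ζ ^ (k + 1))) =
      v ((n + m + 1 : ℕ) : K) := by
  have hv1 : v ζ = 1 := v.eq_one_of_pow_eq_one (Nat.succ_ne_zero _) hζ.pow_eq_one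
  have h := hζ.prod_one_sub_pow_eq_order
  rw [Finset.prod_range_add] at h
  push_cast at h ⊢
  rw [← h, map_mul]
  congr 1
  rw [← Finset.prod_range_reflect (fun x => 1 - ζ ^ (n + x + 1)), map_prod, map_prod]
  refine Finset.prod_congr rfl fun j hj => ?_
  have hj' : j < m := Finset.mem_range.1 hj
  have e : ζ ^ (j + 1) * (1 - ζ ^ (n + (m - 1 - j) + 1)) = -(1 - ζ ^ (j + 1)) := by
    rw [mul_sub, ← pow_add, show j + 1 + (n + (m - 1 - j) + 1) = n + m + 1 by omega,
      hζ.pow_eq_one]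
    ring
  have := congrArg v e
  rwa [map_mul, map_pow, hv1, one_pow, one_mul, AbsoluteValue.map_neg, eq_comm] at this

lemma IsNonarchimedean.abv_one_sub_pow_le (hna : IsNonarchimedean v) {x : K} (hx : v x ≤ 1)
    (i : ℕ) : v (1 - x ^ i) ≤ v (1 - x) := by
  rw [← mul_neg_geom_sum, map_mul]
  refine mul_le_of_le_one_right (v.nonneg _) (hna.sum_le_of_forall_le zero_le_one fun i _ => ?_)
  rw [map_pow]
  exact pow_le_one₀ (by positivity) hx

/-- `|p| ≤ |1 - η|^{φ(N)}` for `η` of order `N = p^{m+1}`. -/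
lemma IsPrimitiveRoot.abv_prime_le_abv_one_sub_pow (hna : IsNonarchimedean v) {p m : ℕ}
    [Fact p.Prime] {η : K} (hη : IsPrimitiveRoot η (p ^ (m + 1))) :
    v (p : K) ≤ v (1 - η) ^ (p ^ (m + 1)).totient := by
  have hpos : p ^ (m + 1) ≠ 0 := pow_ne_zero _ (Fact.out : p.Prime).ne_zero
  have : NeZero (p ^ (m + 1)) := ⟨hpos⟩
  have hv1 : v η = 1 := v.eq_one_of_pow_eq_one hpos hη.pow_eq_one
  have h := Polynomial.eval_one_cyclotomic_prime_pow (R := K) (p := p) m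
  rw [Polynomial.cyclotomic_eq_prod_X_sub_primitiveRoots hη, Polynomial.eval_prod] at h
  rw [← h, map_prod, ← hη.card_primitiveRoots, ← Finset.prod_const]
  refine Finset.prod_le_prod (fun _ _ => v.nonneg _) fun μ hμ => ?_
  obtain ⟨i, -, rfl⟩ := hη.eq_pow_of_pow_eq_one
    (isPrimitiveRoot_of_mem_primitiveRoots hμ).pow_eq_one
  simpa using hna.abv_one_sub_pow_le hv1.le i

lemma IsPrimitiveRoot.abv_prime_pow_gcd_le (hna : IsNonarchimedean v) {p m k : ℕ}
    [Fact p.Prime] {ζ : K} (hζ : IsPrimitiveRoot ζ (p ^ m)) (hk0 : 0 < k) (hk : k < p ^ m) :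
    v (p : K) ^ (Nat.gcd k (p ^ m)) ≤ v (1 - ζ ^ k) ^ (p ^ m).totient := by
  have hp : p.Prime := Fact.out
  obtain ⟨j, hj, hjg⟩ := (Nat.dvd_prime_pow hp).1 (Nat.gcd_dvd_right k (p ^ m))
  have hjm : j < m := by
    refine lt_of_le_of_ne hj fun h => ?_
    rw [h] at hjg
    exact absurd (Nat.le_of_dvd hk0 (hjg ▸ Nat.gcd_dvd_left k (p ^ m))) (not_le.2 hk)
  obtain ⟨l, rfl⟩ := Nat.exists_eq_add_of_lt hjm
  have hprim : IsPrimitiveRoot (ζ ^ k) (p ^ (l + 1)) := by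
    rw [IsPrimitiveRoot.iff_orderOf, orderOf_pow' _ hk0.ne', ← hζ.eq_orderOf, Nat.gcd_comm, hjg,
      show j + l + 1 = l + 1 + j by ring, pow_add p (l + 1) j,
      Nat.mul_div_cancel _ (pow_pos hp.pos j)]
  have htot : (p ^ (j + l + 1)).totient = (p ^ (l + 1)).totient * p ^ j := by
    rw [Nat.totient_prime_pow_succ hp, Nat.totient_prime_pow_succ hp]
    ring
  rw [hjg, htot, pow_mul]
  exact pow_le_pow_left₀ (v.nonneg _) (hprim.abv_prime_le_abv_one_sub_pow hna) _

end AbsoluteValue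

lemma Nat.gcd_eq_sum_divisors_totient {k d : ℕ} (hd : d ≠ 0) :
    Nat.gcd k d = ∑ e ∈ d.divisors with e ∣ k, Nat.totient e := by
  conv_lhs => rw [← Nat.sum_totient (Nat.gcd k d)]
  refine Finset.sum_congr ?_ fun _ _ => rfl
  ext e
  simp [Nat.dvd_gcd_iff, hd, and_comm]

lemma Nat.Prime.mul_sum_gcd_le {p : ℕ} (hp : p.Prime) (m n : ℕ) :
    p * ∑ k ∈ Finset.range n, Nat.gcd (k + 1) (p ^ m) ≤ n * (p + m * (p - 1)) := by
  have hd : p ^ m ≠ 0 := pow_ne_zero _ hp.ne_zero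
  have h : ∑ k ∈ Finset.range n, Nat.gcd (k + 1) (p ^ m) =
      ∑ e ∈ (p ^ m).divisors, Nat.totient e * (n / e) := by
    simp_rw [Nat.gcd_eq_sum_divisors_totient hd, Finset.sum_filter]
    rw [Finset.sum_comm]
    refine Finset.sum_congr rfl fun e _ => ?_
    rw [← Finset.sum_filter, Finset.sum_const, Nat.card_multiples, smul_eq_mul, mul_comm]
  rw [h, Nat.sum_divisors_prime_pow hp, Finset.sum_range_succ', mul_add, add_comm]
  have h1 : ∀ j ∈ Finset.range m,
      p * ((p ^ (j + 1)).totient * (n / p ^ (j + 1))) ≤ n * (p - 1) := by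
    intro j _
    rw [Nat.totient_prime_pow_succ hp]
    calc p * (p ^ j * (p - 1) * (n / p ^ (j + 1)))
        = p ^ (j + 1) * (n / p ^ (j + 1)) * (p - 1) := by ring
      _ ≤ n * (p - 1) := Nat.mul_le_mul_right _ (Nat.mul_div_le _ _)
  have h2 := Finset.sum_le_sum h1
  rw [← Finset.mul_sum, Finset.sum_const, Finset.card_range, smul_eq_mul] at h2
  calc _ ≤ p * n + m * (n * (p - 1)) := by
        refine Nat.add_le_add ?_ h2
        simp
    _ = n * (p + m * (p - 1)) := by ring

section Omega

variable {K : Type*} [Field K] {B : ℕ → ℕ → Polynomial ℤ}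

lemma Finset.sum_range_succ_ite_dvd {M : Type*} [AddCommMonoid M] {t : ℕ} (ht : 0 < t) (n : ℕ)
    (f : ℕ → M) :
    ∑ k ∈ Finset.range (n + 1), (if t ∣ k then f k else 0) =
      ∑ k ∈ Finset.range (n / t + 1), f (k * t) := by
  rw [← Finset.sum_filter]
  symm
  refine Finset.sum_nbij' (fun k => k * t) (fun k => k / t) ?_ ?_ ?_ ?_ ?_
  · intro k hk
    simp only [Finset.mem_range, Nat.lt_succ_iff] at hk
    simpa [Nat.lt_succ_iff] using (Nat.le_div_iff_mul_le ht).1 hk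
  · intro k hk
    simp only [Finset.mem_filter, Finset.mem_range, Nat.lt_succ_iff] at hk ⊢
    exact Nat.div_le_div_right hk.1
  · intro k _
    exact Nat.mul_div_cancel k ht
  · intro k hk
    exact Nat.div_mul_cancel (Finset.mem_filter.1 hk).2
  · intro k _
    rfl

lemma IsPrimitiveRoot.sum_pow_mul_eq_ite {η : K} {t : ℕ} (hη : IsPrimitiveRoot η t) (k : ℕ) :
    ∑ m ∈ Finset.range t, η ^ (m * k) = if t ∣ k then (t : K) else 0 := by
  simp_rw [mul_comm _ k, pow_mul]
  split_ifs with h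
  · simp [(hη.pow_eq_one_iff_dvd k).2 h]
  · have hne : η ^ k ≠ 1 := fun h' => h ((hη.pow_eq_one_iff_dvd k).1 h')
    rw [geom_sum_eq hne, ← pow_mul, mul_comm, pow_mul, hη.pow_eq_one]
    simp

/-- Averaging the `q`-binomial theorem over the `t`-th roots of unity. -/
lemma IsPrimitiveRoot.mul_sum_qBinom_eq (hB0 : ∀ n k : ℕ, n < k → B n k = 0)
    (hB1 : ∀ n k : ℕ, k ≤ n → B n k * (qPoch k * qPoch (n - k)) = qPoch n) {s t : ℕ}
    (hs : 0 < s) (ht : 0 < t) {ζ : K} (hζ : IsPrimitiveRoot ζ (s * t)) (n : ℕ) :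
    (t : K) * ∑ k ∈ Finset.range (n / t + 1), (-1) ^ (k * t) *
        ζ ^ (((k * t + 1).choose 2 : ℤ) - (n * k * t : ℤ)) * Polynomial.aeval ζ (B n (k * t)) =
      ∑ m ∈ Finset.range t, ∏ j ∈ Finset.range n, (1 - ζ ^ (((m * s : ℕ) : ℤ) - j)) := by
  have hζ0 : ζ ≠ 0 := hζ.ne_zero (Nat.mul_pos hs ht).ne'
  have hη : IsPrimitiveRoot (ζ ^ s) t := hζ.pow (Nat.mul_pos hs ht) rfl
  have hprod (m : ℕ) : ∏ j ∈ Finset.range n, (1 - ζ ^ (((m * s : ℕ) : ℤ) - j)) =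
      ∑ k ∈ Finset.range (n + 1), (-1) ^ k * ζ ^ (k.choose 2) * Polynomial.aeval ζ (B n k) *
        (ζ ^ (((m * s : ℕ) : ℤ) - n + 1)) ^ k := by
    rw [← prod_one_sub_mul_pow_eq_sum hB0 hB1, ← Finset.prod_range_reflect]
    refine Finset.prod_congr rfl fun j hj => ?_
    have hj' : j < n := Finset.mem_range.1 hj
    rw [← zpow_natCast ζ j, ← zpow_add₀ hζ0]
    congr 2
    omega
  have hpow (m k : ℕ) : (ζ ^ (((m * s : ℕ) : ℤ) - n + 1)) ^ k =
      ζ ^ ((k : ℤ) - n * k) * (ζ ^ s) ^ (m * k) := by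
    rw [← pow_mul, ← zpow_natCast ζ (s * (m * k)), ← zpow_add₀ hζ0, ← zpow_natCast, ← zpow_mul]
    congr 1
    push_cast
    ring
  simp_rw [hprod, hpow]
  rw [Finset.sum_comm]
  simp_rw [← mul_assoc, ← Finset.mul_sum, hη.sum_pow_mul_eq_ite, mul_ite, mul_zero]
  rw [Finset.sum_range_succ_ite_dvd ht, Finset.mul_sum]
  refine Finset.sum_congr rfl fun k _ => ?_
  have hexp : ζ ^ (((k * t + 1).choose 2 : ℤ) - (n * k * t : ℤ)) =
      ζ ^ ((k * t).choose 2) * ζ ^ (((k * t : ℕ) : ℤ) - n * (k * t : ℕ)) := by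
    rw [← zpow_natCast, ← zpow_add₀ hζ0, Nat.choose_succ_succ' (k * t) 1, Nat.choose_one_right]
    congr 1
    push_cast
    ring
  rw [hexp]
  ring

variable {v : AbsoluteValue K ℝ}

lemma IsPrimitiveRoot.abv_prod_one_sub_zpow_le (hna : IsNonarchimedean v)
    (hB1 : ∀ n k : ℕ, k ≤ n → B n k * (qPoch k * qPoch (n - k)) = qPoch n) {d : ℕ} {ζ : K}
    (hζ : IsPrimitiveRoot ζ d) {a : ℕ} (ha : a < d) (n : ℕ) :
    v (∏ j ∈ Finset.range n, (1 - ζ ^ ((a : ℤ) - j))) ≤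
      v (∏ k ∈ Finset.range n, (1 - ζ ^ (k + 1))) := by
  obtain han | hle := lt_or_ge a n
  · rw [Finset.prod_eq_zero (Finset.mem_range.2 han) (by simp), map_zero]
    exact v.nonneg _
  obtain ⟨b, rfl⟩ := Nat.exists_eq_add_of_le hle
  have hv1 : v ζ = 1 := v.eq_one_of_pow_eq_one (by omega) hζ.pow_eq_one
  have h := congrArg (Polynomial.aeval ζ) (hB1 (n + b) n hle)
  rw [Nat.add_sub_cancel_left, map_mul, map_mul, aeval_qPoch, aeval_qPoch, aeval_qPoch,
    Nat.add_comm n b, Finset.prod_range_add, ← mul_assoc, mul_comm (∏ k ∈ Finset.range b, _)] at h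
  have hb : ∏ k ∈ Finset.range b, (1 - ζ ^ (k + 1)) ≠ 0 := by
    refine Finset.prod_ne_zero_iff.2 fun k hk => sub_ne_zero.2 (Ne.symm ?_)
    exact hζ.pow_ne_one_of_pos_of_lt (Nat.succ_ne_zero k) (by have := Finset.mem_range.1 hk; omega)
  have h' := mul_right_cancel₀ hb h
  have hrefl : ∏ j ∈ Finset.range n, (1 - ζ ^ (((n + b : ℕ) : ℤ) - j)) =
      ∏ x ∈ Finset.range n, (1 - ζ ^ (b + x + 1)) := by
    rw [← Finset.prod_range_reflect]
    refine Finset.prod_congr rfl fun j hj => ?_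
    have hj' : j < n := Finset.mem_range.1 hj
    rw [← zpow_natCast]
    congr 2
    omega
  rw [hrefl, ← h', map_mul]
  exact mul_le_of_le_one_left (v.nonneg _) (hna.aeval_int_le_one hv1.le _)

lemma IsPrimitiveRoot.abv_sum_qBinom_le_one (hna : IsNonarchimedean v) {d : ℕ} (hd : d ≠ 0)
    {ζ : K} (hζ : IsPrimitiveRoot ζ d) {ι : Type*} (s : Finset ι) (a : ι → ℕ) (e : ι → ℤ)
    (P : ι → Polynomial ℤ) :
    v (∑ i ∈ s, (-1) ^ a i * ζ ^ e i * Polynomial.aeval ζ (P i)) ≤ 1 := by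
  have hv1 : v ζ = 1 := v.eq_one_of_pow_eq_one hd hζ.pow_eq_one
  refine hna.sum_le_of_forall_le zero_le_one fun i _ => ?_
  rw [map_mul, map_mul, map_zpow₀, hv1, map_pow, AbsoluteValue.map_neg, map_one]
  simpa using hna.aeval_int_le_one hv1.le (P i)

lemma IsPrimitiveRoot.abv_mul_abv_sum_qBinom_le (hna : IsNonarchimedean v)
    (hB0 : ∀ n k : ℕ, n < k → B n k = 0)
    (hB1 : ∀ n k : ℕ, k ≤ n → B n k * (qPoch k * qPoch (n - k)) = qPoch n) {s t : ℕ}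
    (hs : 0 < s) (ht : 0 < t) {ζ : K} (hζ : IsPrimitiveRoot ζ (s * t)) (n : ℕ) :
    v (t : K) * v (∑ k ∈ Finset.range (n / t + 1), (-1) ^ (k * t) *
        ζ ^ (((k * t + 1).choose 2 : ℤ) - (n * k * t : ℤ)) * Polynomial.aeval ζ (B n (k * t))) ≤
      v (∏ k ∈ Finset.range n, (1 - ζ ^ (k + 1))) := by
  rw [← map_mul, hζ.mul_sum_qBinom_eq hB0 hB1 hs ht]
  refine hna.sum_le_of_forall_le (v.nonneg _) fun m hm => ?_
  refine hζ.abv_prod_one_sub_zpow_le hna hB1 ?_ n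
  rw [mul_comm s t]
  exact Nat.mul_lt_mul_of_pos_right (Finset.mem_range.1 hm) hs

end Omega

lemma exists_forall_inv_le_rpow {p : ℕ} (hp : 1 < p) {ε δ : ℝ} (hδ : 0 < δ) :
    ∃ r₀ : ℕ, 0 < r₀ ∧ ∀ r : ℕ, r₀ ≤ r → ε⁻¹ ≤ (p : ℝ) ^ (δ * r - 1) := by
  have hp1 : (1 : ℝ) < p := by exact_mod_cast hp
  have h : Filter.Tendsto (fun r : ℕ => (p : ℝ) ^ (δ * r - 1)) Filter.atTop Filter.atTop :=
    (tendsto_rpow_atTop_of_base_gt_one _ hp1).comp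
      (Filter.tendsto_atTop_add_const_right _ (-1)
        (tendsto_natCast_atTop_atTop.const_mul_atTop hδ))
  obtain ⟨a, ha⟩ := Filter.eventually_atTop.1 (h.eventually_ge_atTop ε⁻¹)
  exact ⟨a + 1, a.succ_pos, fun r hr => ha r (by omega)⟩

section Size

variable {K : Type*} [Field K] {v : AbsoluteValue K ℝ} {p : ℕ} [Fact p.Prime]

/-- A lower bound for `|(ζ;ζ)_n|`, linear in `n / p ^ m` on the logarithmic scale. -/
lemma IsPrimitiveRoot.rpow_le_abv_prod (hna : IsNonarchimedean v) (hvp : v (p : K) = (p : ℝ)⁻¹)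
    {m n : ℕ} (hm : 0 < m) {ζ : K} (hζ : IsPrimitiveRoot ζ (p ^ m)) (hn : n < p ^ m) :
    (p : ℝ) ^ (-((n : ℝ) / (p : ℝ) ^ m * (m + 2))) ≤
      v (∏ k ∈ Finset.range n, (1 - ζ ^ (k + 1))) := by
  have hp : p.Prime := Fact.out
  have hp2 : (2 : ℝ) ≤ p := by exact_mod_cast hp.two_le
  have hp0 : (0 : ℝ) < p := by linarith
  have hφ : 0 < (p ^ m).totient := Nat.totient_pos.2 (pow_pos hp.pos m)
  set S := ∑ k ∈ Finset.range n, Nat.gcd (k + 1) (p ^ m) with hS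
  have hlow : (p : ℝ)⁻¹ ^ S ≤
      v (∏ k ∈ Finset.range n, (1 - ζ ^ (k + 1))) ^ (p ^ m).totient := by
    rw [hS, ← hvp, ← Finset.prod_pow_eq_pow_sum, map_prod, ← Finset.prod_pow]
    refine Finset.prod_le_prod (fun _ _ => by positivity) fun k hk => ?_
    have := Finset.mem_range.1 hk
    exact hζ.abv_prime_pow_gcd_le hna k.succ_pos (by omega)
  have hφeq : (p : ℝ) * ((p ^ m).totient : ℝ) = (p : ℝ) ^ m * (p - 1) := by
    obtain ⟨l, rfl⟩ := Nat.exists_eq_add_one_of_ne_zero hm.ne'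
    rw [Nat.totient_prime_pow_succ hp]
    push_cast [hp.one_le]
    ring
  have hSle : (S : ℝ) ≤ (n : ℝ) / (p : ℝ) ^ m * (m + 2) * ((p ^ m).totient : ℝ) := by
    have h : (p : ℝ) * S ≤ n * (p + m * (p - 1)) := by
      have h' := hp.mul_sum_gcd_le m n
      rw [← hS] at h'
      have h'' : ((p * S : ℕ) : ℝ) ≤ ((n * (p + m * (p - 1)) : ℕ) : ℝ) := by exact_mod_cast h'
      push_cast [hp.one_le] at h''
      exact h''
    refine le_of_mul_le_mul_left (h.trans ?_) hp0
    calc (n : ℝ) * (p + m * (p - 1)) ≤ n * ((m + 2) * (p - 1)) := by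
          gcongr
          linarith
      _ = (n : ℝ) / (p : ℝ) ^ m * (m + 2) * ((p : ℝ) ^ m * (p - 1)) := by
          field_simp
      _ = _ := by rw [← hφeq]; ring
  refine le_of_pow_le_pow_left₀ hφ.ne' (v.nonneg _) (le_trans ?_ hlow)
  rw [← Real.rpow_mul_natCast hp0.le, inv_pow, ← Real.rpow_natCast (p : ℝ) S,
    ← Real.rpow_neg hp0.le]
  exact Real.rpow_le_rpow_of_exponent_le (by linarith) (by linarith)

lemma IsPrimitiveRoot.rpow_le_pow_mul_abv_prod (hna : IsNonarchimedean v)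
    (hvp : v (p : K) = (p : ℝ)⁻¹) {r n : ℕ} (hr : 0 < r) {ζ : K}
    (hζ : IsPrimitiveRoot ζ (p ^ (2 * r))) {δ : ℝ} (hδ : 0 < δ) (hδ1 : δ < 1)
    (hn : (n : ℝ) ≤ (1 - δ) / 2 * ((p : ℝ) ^ (2 * r) - 1)) :
    (p : ℝ) ^ (δ * r - 1) ≤
      (p : ℝ) ^ r * v (∏ k ∈ Finset.range n, (1 - ζ ^ (k + 1))) := by
  have hp : p.Prime := Fact.out
  have hp1 : (1 : ℝ) ≤ p := by exact_mod_cast hp.one_le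
  have hp0 : (0 : ℝ) < p := by linarith
  have hd : (1 : ℝ) ≤ (p : ℝ) ^ (2 * r) := one_le_pow₀ hp1
  have hn' : (n : ℝ) ≤ (1 - δ) / 2 * (p : ℝ) ^ (2 * r) := by nlinarith
  have hlt : n < p ^ (2 * r) := by
    have : (n : ℝ) < (p : ℝ) ^ (2 * r) := by nlinarith
    exact_mod_cast this
  have h := hζ.rpow_le_abv_prod hna hvp (by omega) hlt
  refine le_trans ?_ (mul_le_mul_of_nonneg_left h (by positivity))
  rw [← Real.rpow_natCast (p : ℝ) r, ← Real.rpow_add hp0]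
  refine Real.rpow_le_rpow_of_exponent_le hp1 ?_
  have hq : (n : ℝ) / (p : ℝ) ^ (2 * r) ≤ (1 - δ) / 2 := (div_le_iff₀ (by positivity)).2 hn'
  have hr0 : (0 : ℝ) ≤ ((2 * r : ℕ) : ℝ) + 2 := by positivity
  have := mul_le_mul_of_nonneg_right hq hr0
  push_cast at this ⊢
  nlinarith

end Size

/-- **The criterion holds outside the critical interval** (Ophir–de Shalit, Lemma 11).
`K` is an algebraic closure of `ℚ_p` with its unique absolute value `v` extending the `p`-adic
one.  For every `ε > 0` and `0 < δ < 1`, if `r` is large enough then for `d = p^{2r}`, `ζ` a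
primitive `d`-th root of unity and every `0 ≤ n ≤ d−1` with
`n ∉ [((1−δ)/2)(d−1), ((1+δ)/2)(d−1)]`, one has
`|Ω_{r,n}(ζ)| ≤ max{1, p^r |(ζ;ζ)_n|}·ε`, where
`Ω_{r,n}(ζ) = Σ_{k=0}^{⌊n/p^r⌋} (−1)^{k p^r} ζ^{(kp^r)(kp^r+1)/2 − n k p^r} [n choose kp^r]_ζ`
and `(ζ;ζ)_n = ∏_{k=1}^n (1 − ζ^k)`.  Here `B` is the Gaussian binomial coefficient
`[n choose k]_q ∈ ℤ[q]`, characterized by `[n choose k]_q (q;q)_k (q;q)_{n−k} = (q;q)_n` for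
`k ≤ n` and `[n choose k]_q = 0` for `k > n`. -/
theorem stmt_14 (p : ℕ) [Fact p.Prime]
    (K : Type*) [Field K] [Algebra ℚ_[p] K] [IsAlgClosure ℚ_[p] K]
    (v : AbsoluteValue K ℝ)
    (hv : ∀ x : ℚ_[p], v (algebraMap ℚ_[p] K x) = ‖x‖)
    (B : ℕ → ℕ → Polynomial ℤ)
    (hB0 : ∀ n k : ℕ, n < k → B n k = 0)
    (hB1 : ∀ n k : ℕ, k ≤ n → B n k * (qPoch k * qPoch (n - k)) = qPoch n)
    (ε δ : ℝ) (hε : 0 < ε) (hδ0 : 0 < δ) (hδ1 : δ < 1) :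
    ∃ r₀ : ℕ, ∀ r : ℕ, r₀ ≤ r → ∀ ζ : K, IsPrimitiveRoot ζ (p ^ (2 * r)) →
      ∀ n : ℕ, n ≤ p ^ (2 * r) - 1 →
        ¬((1 - δ) / 2 * ((p : ℝ) ^ (2 * r) - 1) ≤ (n : ℝ) ∧
            (n : ℝ) ≤ (1 + δ) / 2 * ((p : ℝ) ^ (2 * r) - 1)) →
        v (∑ k ∈ Finset.range (n / p ^ r + 1),
              (-1) ^ (k * p ^ r) *
                ζ ^ (((k * p ^ r + 1).choose 2 : ℤ) - (n * k * p ^ r : ℤ)) *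
                Polynomial.aeval ζ (B n (k * p ^ r)))
          ≤ max 1 ((p : ℝ) ^ r * v (∏ k ∈ Finset.range n, (1 - ζ ^ (k + 1)))) * ε := by
  have hp : p.Prime := Fact.out
  have hvnat (n : ℕ) : v (n : K) = ‖(n : ℚ_[p])‖ := by
    rw [← hv, map_natCast (algebraMap ℚ_[p] K)]
  have hna : IsNonarchimedean v := AbsoluteValue.isNonarchimedean_of_natCast_le_one fun n => by
    rw [hvnat]
    exact IsUltrametricDist.norm_natCast_le_one ℚ_[p] n
  have hvp : v (p : K) = (p : ℝ)⁻¹ := by rw [hvnat, Padic.norm_p]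
  obtain ⟨r₀, hr₀, hr₀'⟩ := exists_forall_inv_le_rpow hp.one_lt (ε := ε) hδ0
  refine ⟨r₀, fun r hr ζ hζ n hn hnot => ?_⟩
  have hbig := hr₀' r hr
  have hrpos : 0 < r := hr₀.trans_le hr
  have hppos : (0 : ℝ) < (p : ℝ) ^ r := pow_pos (by exact_mod_cast hp.pos) r
  have hd : 0 < p ^ (2 * r) := pow_pos hp.pos _
  set V := v (∏ k ∈ Finset.range n, (1 - ζ ^ (k + 1))) with hV
  have hle1 := hζ.abv_sum_qBinom_le_one hna hd.ne' (Finset.range (n / p ^ r + 1))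
    (fun k => k * p ^ r) (fun k => ((k * p ^ r + 1).choose 2 : ℤ) - (n * k * p ^ r : ℤ))
    (fun k => B n (k * p ^ r))
  obtain hlow | hhigh := lt_or_ge (n : ℝ) ((1 - δ) / 2 * ((p : ℝ) ^ (2 * r) - 1))
  · have h := hbig.trans (hζ.rpow_le_pow_mul_abv_prod hna hvp hrpos hδ0 hδ1 hlow.le)
    rw [← hV] at h
    refine hle1.trans ?_
    calc (1 : ℝ) = ε⁻¹ * ε := (inv_mul_cancel₀ hε.ne').symm
      _ ≤ _ := mul_le_mul_of_nonneg_right (h.trans (le_max_right _ _)) hε.le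
  · have hup : (1 + δ) / 2 * ((p : ℝ) ^ (2 * r) - 1) < n := by
      by_contra! h
      exact hnot ⟨hhigh, h⟩
    obtain ⟨m, hm⟩ := Nat.exists_eq_add_of_le hn
    have hdm : p ^ (2 * r) = n + m + 1 := by omega
    have hdm' : (p : ℝ) ^ (2 * r) = n + m + 1 := by exact_mod_cast hdm
    have h := hbig.trans (hζ.rpow_le_pow_mul_abv_prod (n := m) hna hvp hrpos hδ0 hδ1
      (by rw [hdm'] at hup ⊢; linarith))
    set W := v (∏ k ∈ Finset.range m, (1 - ζ ^ (k + 1))) with hW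
    have hVW : ((p : ℝ) ^ r * V) * ((p : ℝ) ^ r * W) = 1 := by
      have hrefl := IsPrimitiveRoot.abv_prod_mul_abv_prod (v := v) (hdm ▸ hζ)
      rw [← hdm, ← hV, ← hW, Nat.cast_pow, map_pow, hvp] at hrefl
      calc ((p : ℝ) ^ r * V) * ((p : ℝ) ^ r * W) = (p : ℝ) ^ (2 * r) * (V * W) := by ring
        _ = 1 := by
          rw [hrefl, inv_pow, mul_inv_cancel₀]
          exact pow_ne_zero _ (by exact_mod_cast hp.ne_zero)
    have hVnn : 0 ≤ (p : ℝ) ^ r * V := mul_nonneg hppos.le (v.nonneg _)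
    have hVε : (p : ℝ) ^ r * V ≤ ε := by
      have := mul_le_mul_of_nonneg_left h hVnn
      rwa [hVW, ← div_eq_mul_inv, div_le_one hε] at this
    have hζ' : IsPrimitiveRoot ζ (p ^ r * p ^ r) := by rwa [← pow_add, ← two_mul]
    have hmain := hζ'.abv_mul_abv_sum_qBinom_le hna hB0 hB1 (pow_pos hp.pos r) (pow_pos hp.pos r) n
    rw [← hV, Nat.cast_pow, map_pow, hvp, inv_pow, inv_mul_le_iff₀ hppos] at hmain
    push_cast at hmain
    calc _ ≤ (p : ℝ) ^ r * V := hmain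
      _ ≤ 1 * ε := by rwa [one_mul]
      _ ≤ _ := mul_le_mul_of_nonneg_right (le_max_left _ _) hε.le
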